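/- Let k be a field of characteristic zero, and let (M, x_M) and (N, x_N) be pairs of vector superspaces over k with odd nilpotent endomorphisms. Let 𝓕^•(M), 𝓕^•(N) be Deligne filtrations for x_M and x_N, and let 𝓕^•(M⊗N) be a Deligne filtration for the odd endomorphism x_{M⊗N} on M ⊗ N (which is nilpotent). Then for all integers a and b: (1) the subspace of M ⊗ N spanned by 𝓕^{2a}(M) ⊗ 𝓕^{2b}(N) is contained in 𝓕^{2(a+b)}(M⊗N); (2) the subspace spanned by 𝓕^{2a−1}(M) ⊗ 𝓕^{2b}(N) together with 𝓕^{2a}(M) ⊗ 𝓕^{2b−1}(N) is contained in 𝓕^{2(a+b)−1}(M⊗N). -/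

import Mathlib

open scoped TensorProduct

section Defs

variable (k : Type*) [Field k]

def IsEvenMap {V : Type*} [AddCommGroup V] [Module k V]
    (V0 V1 : Submodule k V) (f : V →ₗ[k] V) : Prop :=
  (∀ v ∈ V0, f v ∈ V0) ∧ (∀ v ∈ V1, f v ∈ V1)

def IsOddMap {V : Type*} [AddCommGroup V] [Module k V]
    (V0 V1 : Submodule k V) (f : V →ₗ[k] V) : Prop :=
  (∀ v ∈ V0, f v ∈ V1) ∧ (∀ v ∈ V1, f v ∈ V0)

/-- The shift endomorphism of the string module `M_n`: sends basis vector `a_j` to `a_{j+1}`,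
and `a_n` to `0`.  In coordinates, `(x f) j = f (j-1)` for `j ≥ 1` and `(x f) 0 = 0`. -/
def shiftMap (n : ℕ) : (Fin (n+1) → k) →ₗ[k] (Fin (n+1) → k) where
  toFun f := fun j =>
    if (j : ℕ) = 0 then 0 else f ⟨(j : ℕ) - 1, Nat.lt_of_le_of_lt (Nat.sub_le _ _) j.isLt⟩
  map_add' f g := by funext j; dsimp only [Pi.add_apply]; split_ifs <;> simp
  map_smul' c f := by funext j; dsimp only [Pi.smul_apply, RingHom.id_apply]; split_ifs <;> simp

/-- The even (`r = 0`) resp. odd (`r = 1`) part of the string module `Π^ε M_n`: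
coordinates `j` with `(j + ε) % 2 = r`. -/
def stringPart (n ε r : ℕ) : Submodule k (Fin (n+1) → k) :=
  Submodule.pi Set.univ (fun j => if ((j : ℕ) + ε) % 2 = r then (⊤ : Submodule k k) else ⊥)

/-- Isomorphism of pairs (vector superspace with endomorphism): an even linear isomorphism
intertwining the endomorphisms. -/
def PairIso {V : Type*} [AddCommGroup V] [Module k V]
    (V0 V1 : Submodule k V) (x : V →ₗ[k] V)
    {W : Type*} [AddCommGroup W] [Module k W]
    (W0 W1 : Submodule k W) (y : W →ₗ[k] W) : Prop :=
  ∃ φ : V ≃ₗ[k] W, (∀ v ∈ V0, φ v ∈ W0) ∧ (∀ v ∈ V1, φ v ∈ W1) ∧ ∀ v, φ (x v) = y (φ v)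

/-- `V` decomposes as a direct sum of `x`-invariant graded subspaces, each isomorphic as a pair
to some `Π^ε M_n` with `P n`. -/
def DecomposesIntoStrings {V : Type*} [AddCommGroup V] [Module k V]
    (V0 V1 : Submodule k V) (x : V →ₗ[k] V) (P : ℕ → Prop) : Prop :=
  ∃ (m : ℕ) (U : Fin m → Submodule k V), DirectSum.IsInternal U ∧
    ∀ i : Fin m, (U i = (U i ⊓ V0) ⊔ (U i ⊓ V1)) ∧
      ∃ (hx : ∀ v ∈ U i, x v ∈ U i) (n ε : ℕ), ε ≤ 1 ∧ P n ∧
        PairIso k (V0.comap (U i).subtype) (V1.comap (U i).subtype) (x.restrict hx)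
          (stringPart k n ε 0) (stringPart k n ε 1) (shiftMap k n)

/-- A pair `(V, x)` (odd nilpotent `x`) is neat if it decomposes into strings `Π^ε M_{2s}`. -/
def IsNeat {V : Type*} [AddCommGroup V] [Module k V]
    (V0 V1 : Submodule k V) (x : V →ₗ[k] V) : Prop :=
  DecomposesIntoStrings k V0 V1 x (fun n => Even n)

variable {V W : Type*} [AddCommGroup V] [Module k V] [AddCommGroup W] [Module k W]

/-- The set of pure tensors `v ⊗ w` with `v ∈ A`, `w ∈ B`. -/
def pureTensors (A : Submodule k V) (B : Submodule k W) : Set (V ⊗[k] W) :=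
  {t | ∃ v ∈ A, ∃ w ∈ B, t = v ⊗ₜ[k] w}

/-- The even part `(V₀⊗W₀) ⊕ (V₁⊗W₁)` of the tensor product of two superspaces. -/
def tensorEven (V0 V1 : Submodule k V) (W0 W1 : Submodule k W) : Submodule k (V ⊗[k] W) :=
  Submodule.span k (pureTensors k V0 W0 ∪ pureTensors k V1 W1)

/-- The odd part `(V₀⊗W₁) ⊕ (V₁⊗W₀)` of the tensor product of two superspaces. -/
def tensorOdd (V0 V1 : Submodule k V) (W0 W1 : Submodule k W) : Submodule k (V ⊗[k] W) :=
  Submodule.span k (pureTensors k V0 W1 ∪ pureTensors k V1 W0)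

/-- `z` is the super tensor-product endomorphism induced by `x` and `y`:
`z (v ⊗ w) = x v ⊗ w + (-1)^p v ⊗ y w` for `v` homogeneous of parity `p`. -/
def IsSuperTensorMap (V0 V1 : Submodule k V) (x : V →ₗ[k] V) (y : W →ₗ[k] W)
    (z : V ⊗[k] W →ₗ[k] V ⊗[k] W) : Prop :=
  (∀ v ∈ V0, ∀ w : W, z (v ⊗ₜ[k] w) = (x v) ⊗ₜ[k] w + v ⊗ₜ[k] (y w)) ∧
  (∀ v ∈ V1, ∀ w : W, z (v ⊗ₜ[k] w) = (x v) ⊗ₜ[k] w - v ⊗ₜ[k] (y w))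

/-- Componentwise shift endomorphism on a finite direct sum of string modules. -/
def multiShift {N : ℕ} (n : Fin N → ℕ) :
    ((i : Fin N) → (Fin (n i + 1) → k)) →ₗ[k] ((i : Fin N) → (Fin (n i + 1) → k)) :=
  LinearMap.pi (fun i => (shiftMap k (n i)).comp (LinearMap.proj i))

/-- Even/odd part of a finite direct sum of string modules `⊕ᵢ Π^{ε i} M_{n i}`. -/
def multiPart {N : ℕ} (n ε : Fin N → ℕ) (r : ℕ) :
    Submodule k ((i : Fin N) → (Fin (n i + 1) → k)) :=
  Submodule.pi Set.univ (fun i => stringPart k (n i) (ε i) r)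

end Defs

/-- A **Deligne filtration** for a nilpotent endomorphism `x` of a finite-dimensional vector
space `M`. -/
structure IsDeligneFiltration (k : Type*) [Field k] {M : Type*} [AddCommGroup M] [Module k M]
    (F : ℤ → Submodule k M) (x : M →ₗ[k] M) : Prop where
  mono : Monotone F
  eventually_bot : ∃ a : ℤ, ∀ i ≤ a, F i = ⊥
  eventually_top : ∃ b : ℤ, ∀ i : ℤ, b ≤ i → F i = ⊤
  shift : ∀ i : ℤ, ∀ v ∈ F i, x v ∈ F (i - 2)
  gr_surjective : ∀ i : ℤ, 0 ≤ i → ∀ v ∈ F (-i), ∃ u ∈ F i, v - (x ^ i.toNat) u ∈ F (-i - 1)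
  gr_injective : ∀ i : ℤ, 0 ≤ i → ∀ u ∈ F i, (x ^ i.toNat) u ∈ F (-i - 1) → u ∈ F (i - 1)

namespace DelTensor

section Basic
variable {k : Type*} [Field k] {V W : Type*} [AddCommGroup V] [Module k V]
  [AddCommGroup W] [Module k W]

/-- The explicit formula for the weight filtration: `∑ₗ xˡ ker x^{i+2l+1}`. -/
def wt (x : V →ₗ[k] V) (i : ℤ) : Submodule k V :=
  ⨆ l : ℕ, (LinearMap.ker (x ^ (i + 2 * l + 1).toNat)).map (x ^ l)

/-- The dual formula. -/
def dualWt (x : V →ₗ[k] V) (i : ℤ) (v : V) : Prop :=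
  ∀ l : ℕ, ∃ u, (x ^ l) v = (x ^ (2 * (l : ℤ) - i).toNat) u

lemma pow_app_add (x : V →ₗ[k] V) (a b : ℕ) (v : V) : (x ^ a) ((x ^ b) v) = (x ^ (a + b)) v := by
  rw [pow_add]; rfl

lemma pow_app_succ (x : V →ₗ[k] V) (a : ℕ) (v : V) : x ((x ^ a) v) = (x ^ (a + 1)) v := by
  rw [pow_succ']; rfl

lemma pow_app_succ' (x : V →ₗ[k] V) (a : ℕ) (v : V) : (x ^ a) (x v) = (x ^ (a + 1)) v := by
  rw [pow_succ]; rfl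

lemma pow_zero_of_le (x : V →ₗ[k] V) {a b : ℕ} (h : a ≤ b) {v : V} (hv : (x ^ a) v = 0) :
    (x ^ b) v = 0 := by
  obtain ⟨c, rfl⟩ := Nat.exists_eq_add_of_le h
  rw [Nat.add_comm, ← pow_app_add, hv, map_zero]

lemma mem_wt (x : V →ₗ[k] V) (i : ℤ) (l t : ℕ) (u : V) (ht : (t : ℤ) ≤ i + 2 * l + 1)
    (hu : (x ^ t) u = 0) : (x ^ l) u ∈ wt x i := by
  refine Submodule.mem_iSup_of_mem l ⟨u, ?_, rfl⟩
  exact LinearMap.mem_ker.2 (pow_zero_of_le x (by omega) hu)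

lemma wt_le (x : V →ₗ[k] V) (i : ℤ) (S : Submodule k V)
    (h : ∀ (l t : ℕ) (u : V), (t : ℤ) = i + 2 * l + 1 → (x ^ t) u = 0 → (x ^ l) u ∈ S) :
    wt x i ≤ S := by
  refine iSup_le fun l => ?_
  rintro _ ⟨u, hu, rfl⟩
  have hu : (x ^ (i + 2 * l + 1).toNat) u = 0 := hu
  by_cases hl : 0 ≤ i + 2 * l + 1
  · exact h l _ u (by omega) hu
  · rw [show (i + 2 * l + 1).toNat = 0 by omega] at hu
    have : u = 0 := hu
    rw [this, map_zero]; exact S.zero_mem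

lemma wt_map (x : V →ₗ[k] V) (y : W →ₗ[k] W) (φ : V →ₗ[k] W) (h : ∀ v, φ (x v) = y (φ v))
    (i : ℤ) {v : V} (hv : v ∈ wt x i) : φ v ∈ wt y i := by
  have hp : ∀ (n : ℕ) v, φ ((x ^ n) v) = (y ^ n) (φ v) := by
    intro n
    induction n with
    | zero => intro v; rfl
    | succ n ih => intro v; rw [← pow_app_succ, h, ih, pow_app_succ]
  have : wt x i ≤ (wt y i).comap φ := by
    refine wt_le x i _ fun l t u ht hu => ?_
    rw [Submodule.mem_comap, hp]
    exact mem_wt y i l t _ ht.le (by rw [← hp, hu, map_zero])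
  exact this hv

lemma dualWt_of_wt (x : V →ₗ[k] V) (i : ℤ) {v : V} (hv : v ∈ wt x i) : dualWt x i v := by
  intro m
  have : wt x i ≤ (LinearMap.range (x ^ (2 * (m : ℤ) - i).toNat)).comap (x ^ m) := by
    refine wt_le x i _ fun l t u ht hu => ?_
    rw [Submodule.mem_comap, pow_app_add]
    by_cases h : (m : ℤ) ≤ l + i
    · refine ⟨(x ^ (m + l - (2 * (m : ℤ) - i).toNat)) u, ?_⟩
      rw [pow_app_add]
      congr 2
      omega
    · rw [pow_zero_of_le x (by omega) hu]
      exact Submodule.zero_mem _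
  obtain ⟨u, hu⟩ := this hv
  exact ⟨u, hu.symm⟩

lemma wt_of_dualWt (x : V →ₗ[k] V) (hx : IsNilpotent x) (i : ℤ) {v : V} (hv : dualWt x i v) :
    v ∈ wt x i := by
  have key : ∀ n : ℕ, ∃ a, v - (x ^ n) a ∈ wt x i ∧ (x ^ (i + n).toNat) (v - (x ^ n) a) = 0 := by
    intro n
    induction n with
    | zero => exact ⟨v, by simp, by simp⟩
    | succ n ih =>
      obtain ⟨a, ha, ha'⟩ := ih
      by_cases h : 0 ≤ i + n + 1
      · obtain ⟨u, hu⟩ := hv (i + n + 1).toNat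
        rw [show (2 * (((i + n + 1).toNat : ℕ) : ℤ) - i).toNat = (i + n + 1).toNat + (n + 1) by
          omega, ← pow_app_add] at hu
        have h0 : (x ^ (i + n + 1).toNat) (v - (x ^ (n + 1)) u) = 0 := by
          rw [map_sub, hu, sub_self]
        refine ⟨u, ?_, ?_⟩
        · have e : v - (x ^ (n + 1)) u = (v - (x ^ n) a) + (x ^ n) (a - x u) := by
            rw [map_sub, pow_app_succ']; abel
          have h1 : (x ^ (i + n + 1).toNat) (v - (x ^ n) a) = 0 :=
            pow_zero_of_le x (by omega) ha'
          have h2 : (x ^ ((i + n + 1).toNat + n)) (a - x u) = 0 := by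
            rw [e, map_add, h1, zero_add, pow_app_add] at h0
            exact h0
          rw [e]
          exact Submodule.add_mem _ ha (mem_wt x i n _ _ (by omega) h2)
        · rw [show (i + ((n + 1 : ℕ) : ℤ)) = i + n + 1 by push_cast; ring]
          exact h0
      · obtain ⟨u, hu⟩ := hv 0
        rw [show (2 * ((0 : ℕ) : ℤ) - i).toNat = (n + 1) + (-i - n - 1).toNat by omega,
          ← pow_app_add] at hu
        have hu : v = _ := hu
        refine ⟨(x ^ (-i - n - 1).toNat) u, ?_, ?_⟩
        · rw [← hu, sub_self]; exact Submodule.zero_mem _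
        · rw [← hu, sub_self, map_zero]
  obtain ⟨n, hn⟩ := hx
  obtain ⟨a, ha, -⟩ := key n
  simpa [hn] using ha

lemma ker_le_deligne {F : ℤ → Submodule k V} {x : V →ₗ[k] V} (hF : IsDeligneFiltration k F x)
    (n : ℤ) (t : ℕ) (ht : (t : ℤ) ≤ n + 1) (u : V) (hn : -1 ≤ n) (hu : (x ^ t) u = 0) :
    u ∈ F n := by
  obtain ⟨b, hb⟩ := hF.eventually_top
  have key : ∀ j : ℕ, u ∈ F (n + (b - n).toNat - j) ∨ (n + (b - n).toNat - j < n) := by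
    intro j
    induction j with
    | zero => left; rw [hb _ (by omega)]; trivial
    | succ j ih =>
      rcases ih with ih | ih
      · by_cases h : n < n + (b - n).toNat - j
        · left
          have := hF.gr_injective _ (by omega) u ih (by
            rw [pow_zero_of_le x (by omega) hu]; exact Submodule.zero_mem _)
          convert this using 2
          push_cast; ring
        · right; push_cast; omega
      · right; push_cast; omega
  rcases key (b - n).toNat with h | h
  · simpa using h
  · omega

lemma wt_le_deligne {F : ℤ → Submodule k V} {x : V →ₗ[k] V} (hF : IsDeligneFiltration k F x)
    (i : ℤ) : wt x i ≤ F i := by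
  refine wt_le x i _ fun l t u ht hu => ?_
  have h1 := ker_le_deligne hF (i + 2 * l) t (by omega) u (by omega) hu
  have h2 : ∀ m : ℕ, (x ^ m) u ∈ F (i + 2 * l - 2 * m) := by
    intro m
    induction m with
    | zero => simpa using h1
    | succ m ih =>
      rw [← pow_app_succ]
      convert hF.shift _ _ ih using 2
      push_cast; ring
  simpa using h2 l

lemma deligne_neg_le {F : ℤ → Submodule k V} {x : V →ₗ[k] V} (hF : IsDeligneFiltration k F x)
    (n c : ℕ) : ∀ v ∈ F (-(c : ℤ)), (∀ i : ℤ, i ≤ -(c : ℤ) - n → F i = ⊥) →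
      ∃ u, v = (x ^ c) u := by
  induction n generalizing c with
  | zero =>
    intro v hv h
    rw [h _ (by simp)] at hv
    exact ⟨0, by simpa using hv⟩
  | succ n ih =>
    intro v hv h
    obtain ⟨u, -, hu⟩ := hF.gr_surjective c (by omega) v hv
    obtain ⟨u', hu'⟩ := ih (c + 1) _ (by
      convert hu using 2
      push_cast; ring) (fun i hi => h i (by push_cast at *; omega))
    refine ⟨u + x u', ?_⟩
    rw [map_add, pow_app_succ', ← hu']
    simp

lemma deligne_le_dualWt {F : ℤ → Submodule k V} {x : V →ₗ[k] V} (hF : IsDeligneFiltration k F x)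
    (i : ℤ) (v : V) (hv : v ∈ F i) : dualWt x i v := by
  have h2 : ∀ m : ℕ, (x ^ m) v ∈ F (i - 2 * m) := by
    intro m
    induction m with
    | zero => simpa using hv
    | succ m ih =>
      rw [← pow_app_succ]
      convert hF.shift _ _ ih using 2
      push_cast; ring
  intro l
  by_cases h : 0 ≤ 2 * (l : ℤ) - i
  · obtain ⟨a, ha⟩ := hF.eventually_bot
    refine deligne_neg_le hF (-a).toNat _ _ ?_ (fun j hj => ha j (by omega))
    convert h2 l using 2
    omega
  · rw [show (2 * (l : ℤ) - i).toNat = 0 by omega]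
    exact ⟨_, rfl⟩

lemma deligne_le_wt {F : ℤ → Submodule k V} {x : V →ₗ[k] V} (hF : IsDeligneFiltration k F x)
    (hx : IsNilpotent x) (i : ℤ) : F i ≤ wt x i :=
  fun v hv => wt_of_dualWt x hx i (deligne_le_dualWt hF i v hv)

lemma sq_pow (x : V →ₗ[k] V) (n : ℕ) : (x ^ 2) ^ n = x ^ (2 * n) := (pow_mul x 2 n).symm

/-- Relation with the filtration of the square, even index. -/
lemma wt_even_le (x : V →ₗ[k] V) (a : ℤ) {v : V} (hv : v ∈ wt x (2 * a)) :
    v ∈ wt (x ^ 2) a ∧ x v ∈ wt (x ^ 2) (a - 1) := by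
  have : wt x (2 * a) ≤ wt (x ^ 2) a ⊓ (wt (x ^ 2) (a - 1)).comap x := by
    refine wt_le x _ _ fun l t u ht hu => ?_
    rw [Submodule.mem_inf, Submodule.mem_comap]
    obtain ⟨m, rfl | rfl⟩ := Nat.even_or_odd' l
    · constructor
      · rw [← sq_pow]
        refine mem_wt _ _ _ (a + 2 * m + 1).toNat _ (by push_cast at *; omega) ?_
        rw [sq_pow]
        exact pow_zero_of_le x (by push_cast at *; omega) hu
      · rw [pow_app_succ, ← pow_app_succ', ← sq_pow]
        refine mem_wt _ _ _ (a + 2 * m).toNat _ (by push_cast at *; omega) ?_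
        rw [sq_pow, pow_app_succ']
        exact pow_zero_of_le x (by push_cast at *; omega) hu
    · constructor
      · rw [← pow_app_succ', ← sq_pow]
        refine mem_wt _ _ _ (a + 2 * m + 1).toNat _ (by push_cast at *; omega) ?_
        rw [sq_pow, pow_app_succ']
        exact pow_zero_of_le x (by push_cast at *; omega) hu
      · rw [pow_app_succ, show 2 * m + 1 + 1 = 2 * (m + 1) by ring, ← sq_pow]
        refine mem_wt _ _ _ (a + 2 * m + 2).toNat _ (by push_cast at *; omega) ?_
        rw [sq_pow]
        exact pow_zero_of_le x (by push_cast at *; omega) hu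
  exact this hv

lemma wt_odd_le (x : V →ₗ[k] V) (a : ℤ) {v : V} (hv : v ∈ wt x (2 * a - 1)) :
    ∃ e ∈ wt (x ^ 2) (a - 1), ∃ v' ∈ wt (x ^ 2) a, v = e + x v' := by
  have : wt x (2 * a - 1) ≤ wt (x ^ 2) (a - 1) ⊔ (wt (x ^ 2) a).map x := by
    refine wt_le x _ _ fun l t u ht hu => ?_
    obtain ⟨m, rfl | rfl⟩ := Nat.even_or_odd' l
    · refine Submodule.mem_sup_left ?_
      rw [← sq_pow]
      refine mem_wt _ _ _ (a + 2 * m).toNat _ (by push_cast at *; omega) ?_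
      rw [sq_pow]
      exact pow_zero_of_le x (by push_cast at *; omega) hu
    · refine Submodule.mem_sup_right ⟨((x ^ 2) ^ m) u, ?_, ?_⟩
      · refine mem_wt _ _ _ (a + 2 * m + 1).toNat _ (by push_cast at *; omega) ?_
        rw [sq_pow]
        exact pow_zero_of_le x (by push_cast at *; omega) hu
      · rw [sq_pow, pow_app_succ]
  obtain ⟨e, he, _, ⟨v', hv', rfl⟩, h⟩ := Submodule.mem_sup.1 (this hv)
  exact ⟨e, he, v', hv', h.symm⟩

lemma wt_sq_odd (x : V →ₗ[k] V) (a : ℤ) {v : V} (hv : v ∈ wt (x ^ 2) (a - 1)) :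
    v ∈ wt x (2 * a - 1) := by
  have : wt (x ^ 2) (a - 1) ≤ wt x (2 * a - 1) := by
    refine wt_le _ _ _ fun l t u ht hu => ?_
    rw [sq_pow] at hu ⊢
    exact mem_wt _ _ _ _ _ (by push_cast; omega) hu
  exact this hv

lemma wt_sq_odd' (x : V →ₗ[k] V) (a : ℤ) {v : V} (hv : v ∈ wt (x ^ 2) a) :
    x v ∈ wt x (2 * a - 1) := by
  have : wt (x ^ 2) a ≤ (wt x (2 * a - 1)).comap x := by
    refine wt_le _ _ _ fun l t u ht hu => ?_
    rw [sq_pow] at hu ⊢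
    rw [Submodule.mem_comap, pow_app_succ]
    exact mem_wt _ _ _ _ _ (by push_cast; omega) hu
  exact this hv

lemma wt_sq_even (x : V →ₗ[k] V) (hx : IsNilpotent x) (a : ℤ) {v : V} (hv : v ∈ wt (x ^ 2) a)
    (hv' : x v ∈ wt (x ^ 2) (a - 1)) : v ∈ wt x (2 * a) := by
  refine wt_of_dualWt x hx _ fun l => ?_
  obtain ⟨m, rfl | rfl⟩ := Nat.even_or_odd' l
  · obtain ⟨u, hu⟩ := dualWt_of_wt _ _ hv m
    refine ⟨u, ?_⟩
    rw [sq_pow, sq_pow] at hu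
    rw [hu]
    congr 2
    push_cast; omega
  · obtain ⟨u, hu⟩ := dualWt_of_wt _ _ hv' m
    refine ⟨u, ?_⟩
    rw [sq_pow, sq_pow, pow_app_succ'] at hu
    rw [hu]
    congr 2
    push_cast; omega

end Basic

section Sl2
variable {k : Type*} [Field k] [CharZero k] {V : Type*} [AddCommGroup V] [Module k V]

lemma sl2_H (E H : V →ₗ[k] V) (c : k) (hHE : ∀ v, H (E v) = E (H v) + c • E v)
    (q : V) (μ : k) (hq : H q = μ • q) (j : ℕ) : H ((E ^ j) q) = (μ + c * j) • (E ^ j) q := by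
  induction j with
  | zero => simpa using hq
  | succ j ih =>
    rw [← pow_app_succ, hHE, ih, map_smul, ← add_smul]
    congr 1
    push_cast; ring

lemma sl2_FE (E F H : V →ₗ[k] V) (hEF : ∀ v, E (F v) = F (E v) + H v)
    (hHE : ∀ v, H (E v) = E (H v) + (2 : k) • E v)
    (q : V) (μ : k) (hF : F q = 0) (hq : H q = (-μ) • q) (j : ℕ) :
    F ((E ^ (j + 1)) q) = ((j + 1) * (μ - j)) • (E ^ j) q := by
  induction j with
  | zero =>
    have := hEF q
    rw [hF, map_zero, hq] at this
    simp only [zero_add, pow_one, pow_zero, Module.End.one_apply]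
    rw [eq_neg_of_add_eq_zero_left this.symm, ← neg_smul]
    congr 1
    simp
  | succ j ih =>
    have := hEF ((E ^ (j + 1)) q)
    rw [ih, map_smul, pow_app_succ, pow_app_succ, sl2_H E H 2 hHE q _ hq] at this
    rw [← sub_eq_iff_eq_add, ← sub_smul] at this
    rw [← this]
    congr 1
    push_cast; ring

lemma sl2_FtE (E F H : V →ₗ[k] V) (hEF : ∀ v, E (F v) = F (E v) + H v)
    (hHE : ∀ v, H (E v) = E (H v) + (2 : k) • E v)
    (q : V) (μ : ℕ) (hF : F q = 0) (hq : H q = (-(μ : k)) • q) (t j : ℕ) (h : j + t ≤ μ) :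
    ∃ c : k, c ≠ 0 ∧ (F ^ t) ((E ^ (j + t)) q) = c • (E ^ j) q := by
  induction t with
  | zero => exact ⟨1, one_ne_zero, by simp⟩
  | succ t ih =>
    obtain ⟨c, hc, e⟩ := ih (by omega)
    refine ⟨(((j + t : ℕ) : k) + 1) * ((μ : k) - ((j + t : ℕ) : k)) * c, ?_, ?_⟩
    · refine mul_ne_zero (mul_ne_zero (Nat.cast_add_one_ne_zero _) ?_) hc
      rw [sub_ne_zero]
      exact_mod_cast (by omega : μ ≠ j + t)
    · rw [← pow_app_succ', ← add_assoc, sl2_FE E F H hEF hHE q μ hF hq, map_smul, e, smul_smul]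

lemma sl2_wt (E F H : V →ₗ[k] V) (hEF : ∀ v, E (F v) = F (E v) + H v)
    (hHE : ∀ v, H (E v) = E (H v) + (2 : k) • E v)
    (hHF : ∀ v, H (F v) = F (H v) + (-2 : k) • F v) (w : ℤ) (n : ℕ) :
    ∀ v, H v = (w : k) • v → (F ^ n) v = 0 → v ∈ wt F w := by
  induction n with
  | zero =>
    intro v _ h
    have : v = 0 := h
    rw [this]; exact Submodule.zero_mem _
  | succ n ih =>
    intro v hv h
    by_cases hn : (n : ℤ) ≤ w
    · exact mem_wt F w 0 (n + 1) v (by push_cast; omega) h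
    · obtain ⟨μ, hμ⟩ : ∃ μ : ℕ, (μ : ℤ) = 2 * n - w := ⟨(2 * n - w).toNat, by omega⟩
      have hμk : (μ : k) = 2 * n - w := by exact_mod_cast congrArg (Int.cast : ℤ → k) hμ
      have hFq : F ((F ^ n) v) = 0 := by rw [pow_app_succ, h]
      have hHq : H ((F ^ n) v) = (-(μ : k)) • (F ^ n) v := by
        rw [sl2_H F H (-2) hHF v _ hv, hμk]
        congr 1; ring
      obtain ⟨c, hc, e⟩ := sl2_FtE E F H hEF hHE _ μ hFq hHq n 0 (by omega)
      rw [zero_add, pow_zero, Module.End.one_apply] at e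
      have m1 : (E ^ n) ((F ^ n) v) ∈ wt F w := by
        obtain ⟨d, hd, f⟩ := sl2_FtE E F H hEF hHE _ μ hFq hHq (μ - n) n (by omega)
        obtain ⟨d', hd', f'⟩ := sl2_FtE E F H hEF hHE _ μ hFq hHq μ 0 (by omega)
        rw [show n + (μ - n) = μ by omega] at f
        rw [zero_add, pow_zero, Module.End.one_apply] at f'
        have : (F ^ (μ - n)) ((E ^ μ) ((F ^ n) v)) ∈ wt F w := by
          refine mem_wt F w _ (μ + 1) _ (by omega) ?_
          rw [← pow_app_succ, f', map_smul, hFq, smul_zero]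
        rw [f] at this
        exact (Submodule.smul_mem_iff _ hd).1 this
      have m2 : v - c⁻¹ • (E ^ n) ((F ^ n) v) ∈ wt F w := by
        refine ih _ ?_ ?_
        · rw [map_sub, map_smul, hv, sl2_H E H 2 hHE _ _ hHq, smul_sub, smul_comm (w : k)]
          congr 3
          rw [hμk]; ring
        · rw [map_sub, map_smul, e, smul_smul, inv_mul_cancel₀ hc, one_smul, sub_self]
      have := Submodule.add_mem _ m2 (Submodule.smul_mem _ c⁻¹ m1)
      simpa using this

end Sl2

section Model
variable (k : Type*) [Field k] (n : ℕ)

noncomputable def mF : (ℕ →₀ k) →ₗ[k] (ℕ →₀ k) :=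
  Finsupp.linearCombination k fun i => if i < n then Finsupp.single (i + 1) (1 : k) else 0

noncomputable def mE : (ℕ →₀ k) →ₗ[k] (ℕ →₀ k) :=
  Finsupp.linearCombination k fun i =>
    if i ≤ n then ((i : k) * (n - i + 1)) • Finsupp.single (i - 1) (1 : k) else 0

noncomputable def mH : (ℕ →₀ k) →ₗ[k] (ℕ →₀ k) :=
  Finsupp.linearCombination k fun i =>
    if i ≤ n then ((n : k) - 2 * i) • Finsupp.single i (1 : k) else 0

lemma mF_s (i : ℕ) : mF k n (Finsupp.single i 1) =
    if i < n then Finsupp.single (i + 1) (1 : k) else 0 := by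
  simp [mF, Finsupp.linearCombination_single]

lemma mE_s (i : ℕ) : mE k n (Finsupp.single i 1) =
    if i ≤ n then ((i : k) * (n - i + 1)) • Finsupp.single (i - 1) (1 : k) else 0 := by
  rw [mE, Finsupp.linearCombination_single, one_smul]

lemma mH_s (i : ℕ) : mH k n (Finsupp.single i 1) =
    if i ≤ n then ((n : k) - 2 * i) • Finsupp.single i (1 : k) else 0 := by
  rw [mH, Finsupp.linearCombination_single, one_smul]

lemma ext_s {V : Type*} [AddCommGroup V] [Module k V] {f g : (ℕ →₀ k) →ₗ[k] V}
    (h : ∀ i, f (Finsupp.single i 1) = g (Finsupp.single i 1)) : f = g := by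
  refine Finsupp.lhom_ext fun i b => ?_
  rw [← mul_one b, ← smul_eq_mul, ← Finsupp.smul_single, map_smul, map_smul, h]

lemma m_EF : mE k n ∘ₗ mF k n = mF k n ∘ₗ mE k n + mH k n := by
  refine ext_s k fun i => ?_
  simp only [LinearMap.comp_apply, LinearMap.add_apply, mF_s, mE_s, mH_s]
  rcases lt_trichotomy i n with h | rfl | h
  · rw [if_pos h, if_pos h.le, if_pos h.le, mE_s, if_pos (by omega), map_smul, mF_s,
      if_pos (by omega)]
    rcases i with _ | i
    · simp
    · simp only [Nat.add_sub_cancel, ← add_smul]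
      congr 1
      push_cast; ring
  · rw [if_neg (by omega), if_pos le_rfl, if_pos le_rfl, map_zero, map_smul, mF_s]
    rcases i with _ | i
    · simp
    · rw [if_pos (by omega)]
      simp only [Nat.add_sub_cancel, ← add_smul]
      symm
      convert zero_smul k _ using 2
      push_cast; ring
  · rw [if_neg (by omega), if_neg (by omega), if_neg (by omega)]
    simp

lemma m_HE : mH k n ∘ₗ mE k n = mE k n ∘ₗ mH k n + (2 : k) • mE k n := by
  refine ext_s k fun i => ?_
  simp only [LinearMap.comp_apply, LinearMap.add_apply, LinearMap.smul_apply, mE_s, mH_s]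
  by_cases h : i ≤ n
  · rw [if_pos h, if_pos h, map_smul, map_smul, mH_s, mE_s, if_pos (by omega), if_pos h]
    rcases i with _ | i
    · simp
    · simp only [Nat.add_sub_cancel, ← add_smul, smul_smul]
      congr 1
      push_cast; ring
  · rw [if_neg h, if_neg h]; simp

lemma m_HF : mH k n ∘ₗ mF k n = mF k n ∘ₗ mH k n + (-2 : k) • mF k n := by
  refine ext_s k fun i => ?_
  simp only [LinearMap.comp_apply, LinearMap.add_apply, LinearMap.smul_apply, mF_s, mH_s]
  by_cases h : i < n
  · rw [if_pos h, if_pos h.le, map_smul, mH_s, mF_s, if_pos (by omega), if_pos h, ← add_smul]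
    congr 1
    push_cast; ring
  · rw [if_neg h]
    by_cases h' : i ≤ n
    · rw [if_pos h', map_smul, mF_s, if_neg h]; simp
    · rw [if_neg h']; simp

lemma m_nil : IsNilpotent (mF k n) := by
  refine ⟨n + 1, ext_s k fun i => ?_⟩
  have key : ∀ t : ℕ, ((mF k n) ^ t) (Finsupp.single i 1) =
      if t = 0 ∨ i + t ≤ n then Finsupp.single (i + t) (1 : k) else 0 := by
    intro t
    induction t with
    | zero => simp
    | succ t ih =>
      rw [← pow_app_succ, ih]
      by_cases h : t = 0 ∨ i + t ≤ n
      · rw [if_pos h, mF_s]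
        by_cases h' : i + t < n
        · rw [if_pos h', if_pos (by omega), add_assoc]
        · rw [if_neg h', if_neg (by omega)]
      · rw [if_neg h, map_zero, if_neg (by omega)]
  rw [key, if_neg (by omega)]; rfl

variable {k} {n}
variable {V : Type*} [AddCommGroup V] [Module k V]

noncomputable def mφ (n : ℕ) (x : V →ₗ[k] V) (u : V) : (ℕ →₀ k) →ₗ[k] V :=
  Finsupp.linearCombination k fun i => if i ≤ n then (x ^ i) u else 0

lemma mφ_s (x : V →ₗ[k] V) (u : V) (i : ℕ) : mφ n x u (Finsupp.single i 1) =
    if i ≤ n then (x ^ i) u else 0 := by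
  rw [mφ, Finsupp.linearCombination_single, one_smul]

lemma mφ_int (x : V →ₗ[k] V) (u : V) (hu : (x ^ (n + 1)) u = 0) :
    mφ n x u ∘ₗ mF k n = x ∘ₗ mφ n x u := by
  refine ext_s k fun i => ?_
  simp only [LinearMap.comp_apply, mF_s, mφ_s]
  rcases lt_trichotomy i n with h | rfl | h
  · rw [if_pos h, if_pos h.le, mφ_s, if_pos (by omega), pow_app_succ]
  · rw [if_neg (by omega), if_pos le_rfl, pow_app_succ, hu, map_zero]
  · rw [if_neg (by omega), if_neg (by omega)]; simp

end Model

section Tensor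
variable {k : Type*} [Field k] {V W : Type*} [AddCommGroup V] [Module k V]
  [AddCommGroup W] [Module k W]

/-- Sum action on the tensor product. -/
noncomputable def tsum' (x : V →ₗ[k] V) (y : W →ₗ[k] W) : V ⊗[k] W →ₗ[k] V ⊗[k] W :=
  TensorProduct.map x LinearMap.id + TensorProduct.map LinearMap.id y

lemma tsum_tmul (x : V →ₗ[k] V) (y : W →ₗ[k] W) (v : V) (w : W) :
    tsum' x y (v ⊗ₜ w) = x v ⊗ₜ w + v ⊗ₜ y w := by
  simp [tsum']

lemma map_pow_id (x : V →ₗ[k] V) (n : ℕ) :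
    (TensorProduct.map x (LinearMap.id : W →ₗ[k] W)) ^ n = TensorProduct.map (x ^ n) LinearMap.id := by
  induction n with
  | zero => ext; simp
  | succ n ih => rw [pow_succ, ih]; ext; simp [pow_succ]

lemma map_id_pow (y : W →ₗ[k] W) (n : ℕ) :
    (TensorProduct.map (LinearMap.id : V →ₗ[k] V) y) ^ n = TensorProduct.map LinearMap.id (y ^ n) := by
  induction n with
  | zero => ext; simp
  | succ n ih => rw [pow_succ, ih]; ext; simp [pow_succ]

lemma tsum_nil (x : V →ₗ[k] V) (y : W →ₗ[k] W) (hx : IsNilpotent x) (hy : IsNilpotent y) :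
    IsNilpotent (tsum' x y) := by
  refine Commute.isNilpotent_add ?_ ?_ ?_
  · refine LinearMap.ext fun t => ?_
    induction t with
    | zero => simp
    | tmul v w => simp
    | add a b ha hb => rw [map_add, map_add, ha, hb]
  · obtain ⟨n, hn⟩ := hx
    exact ⟨n, by rw [map_pow_id, hn, TensorProduct.map_zero_left]⟩
  · obtain ⟨n, hn⟩ := hy
    exact ⟨n, by rw [map_id_pow, hn, TensorProduct.map_zero_right]⟩

lemma tsum_comm (a b c : V →ₗ[k] V) (a' b' c' : W →ₗ[k] W)
    (h : ∀ v, a (b v) = b (a v) + c v) (h' : ∀ v, a' (b' v) = b' (a' v) + c' v) (t : V ⊗[k] W) :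
    tsum' a a' (tsum' b b' t) = tsum' b b' (tsum' a a' t) + tsum' c c' t := by
  induction t with
  | zero => simp
  | tmul v w =>
    simp only [tsum_tmul, map_add, h, h', TensorProduct.add_tmul, TensorProduct.tmul_add]
    abel
  | add s t hs ht => simp only [map_add, hs, ht]; abel

lemma tsum_smul (c : k) (a : V →ₗ[k] V) (a' : W →ₗ[k] W) (t : V ⊗[k] W) :
    tsum' (c • a) (c • a') t = c • tsum' a a' t := by
  induction t with
  | zero => simp
  | tmul v w => simp [tsum_tmul, TensorProduct.smul_tmul']
  | add s t hs ht => simp only [map_add, hs, ht, smul_add]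

lemma wt_tensor [CharZero k] (x : V →ₗ[k] V) (y : W →ₗ[k] W) (a b : ℤ) {v : V} {w : W}
    (hv : v ∈ wt x a) (hw : w ∈ wt y b) : v ⊗ₜ[k] w ∈ wt (tsum' x y) (a + b) := by
  have gen : ∀ (l t : ℕ) (u : V), (t : ℤ) = a + 2 * l + 1 → (x ^ t) u = 0 →
      ∀ (l' t' : ℕ) (u' : W), (t' : ℤ) = b + 2 * l' + 1 → (y ^ t') u' = 0 →
      ((x ^ l) u) ⊗ₜ[k] ((y ^ l') u') ∈ wt (tsum' x y) (a + b) := by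
    intro l t u ht hu l' t' u' ht' hu'
    by_cases hl : t ≤ l
    · rw [pow_zero_of_le x hl hu, TensorProduct.zero_tmul]; exact Submodule.zero_mem _
    by_cases hl' : t' ≤ l'
    · rw [pow_zero_of_le y hl' hu', TensorProduct.tmul_zero]; exact Submodule.zero_mem _
    obtain ⟨n, rfl⟩ : ∃ n, t = n + 1 := ⟨t - 1, by omega⟩
    obtain ⟨m, rfl⟩ : ∃ m, t' = m + 1 := ⟨t' - 1, by omega⟩
    have e1 : mφ n x u (Finsupp.single l 1) = (x ^ l) u := by rw [mφ_s, if_pos (by omega)]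
    have e2 : mφ m y u' (Finsupp.single l' 1) = (y ^ l') u' := by rw [mφ_s, if_pos (by omega)]
    rw [← e1, ← e2, ← TensorProduct.map_tmul]
    refine wt_map (tsum' (mF k n) (mF k m)) _ _ ?_ _ ?_
    · intro s
      induction s with
      | zero => simp
      | tmul p q =>
        have h1 := LinearMap.congr_fun (mφ_int x u hu) p
        have h2 := LinearMap.congr_fun (mφ_int y u' hu') q
        simp only [LinearMap.comp_apply] at h1 h2
        simp only [tsum_tmul, map_add, TensorProduct.map_tmul, h1, h2]
      | add s t hs ht => simp only [map_add, hs, ht]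
    · obtain ⟨N, hN⟩ := tsum_nil (mF k n) (mF k m) (m_nil k n) (m_nil k m)
      refine sl2_wt (tsum' (mE k n) (mE k m)) _ (tsum' (mH k n) (mH k m)) ?_ ?_ ?_ _ N _ ?_ ?_
      · exact tsum_comm _ _ _ _ _ _ (fun v => LinearMap.congr_fun (m_EF k n) v)
          (fun v => LinearMap.congr_fun (m_EF k m) v)
      · intro t
        rw [← tsum_smul]
        exact tsum_comm _ _ _ _ _ _ (fun v => LinearMap.congr_fun (m_HE k n) v)
          (fun v => LinearMap.congr_fun (m_HE k m) v) t
      · intro t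
        rw [← tsum_smul]
        exact tsum_comm _ _ _ _ _ _ (fun v => LinearMap.congr_fun (m_HF k n) v)
          (fun v => LinearMap.congr_fun (m_HF k m) v) t
      · rw [tsum_tmul, mH_s, mH_s, if_pos (by omega), if_pos (by omega),
          ← TensorProduct.smul_tmul', TensorProduct.tmul_smul, ← add_smul]
        congr 1
        have h1 : (n : ℤ) = a + 2 * l := by push_cast at ht; omega
        have h2 : (m : ℤ) = b + 2 * l' := by push_cast at ht'; omega
        have h1 : (n : k) = a + 2 * l := by exact_mod_cast congrArg (Int.cast : ℤ → k) h1
        have h2 : (m : k) = b + 2 * l' := by exact_mod_cast congrArg (Int.cast : ℤ → k) h2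
        rw [h1, h2]; push_cast; ring
      · rw [hN]; rfl
  have s1 : wt x a ≤ (wt (tsum' x y) (a + b)).comap ((TensorProduct.mk k V W).flip w) := by
    refine wt_le x a _ fun l t u ht hu => ?_
    have s2 : wt y b ≤ (wt (tsum' x y) (a + b)).comap (TensorProduct.mk k V W ((x ^ l) u)) :=
      wt_le y b _ fun l' t' u' ht' hu' => gen l t u ht hu l' t' u' ht' hu'
    exact s2 hw
  exact s1 hv

end Tensor

lemma exists_parity {k : Type*} [Field k] {M : Type*} [AddCommGroup M] [Module k M]
    (M0 M1 : Submodule k M) (hc : IsCompl M0 M1) :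
    ∃ σ : M →ₗ[k] M, (∀ v ∈ M0, σ v = v) ∧ (∀ v ∈ M1, σ v = -v) := by
  refine ⟨LinearMap.ofIsCompl hc M0.subtype (-M1.subtype), fun v hv => ?_, fun v hv => ?_⟩
  · exact LinearMap.ofIsCompl_apply_left hc (⟨v, hv⟩ : M0)
  · exact LinearMap.ofIsCompl_apply_right hc (⟨v, hv⟩ : M1)

end DelTensor

open DelTensor in
theorem deligne_filtration_tensor {k : Type*} [Field k] [CharZero k]
    (M : Type*) [AddCommGroup M] [Module k M] [FiniteDimensional k M]
    (M0 M1 : Submodule k M) (hcM : IsCompl M0 M1)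
    (xM : M →ₗ[k] M) (hxModd : IsOddMap k M0 M1 xM) (hxMnil : IsNilpotent xM)
    (N : Type*) [AddCommGroup N] [Module k N] [FiniteDimensional k N]
    (N0 N1 : Submodule k N) (hcN : IsCompl N0 N1)
    (xN : N →ₗ[k] N) (hxNodd : IsOddMap k N0 N1 xN) (hxNnil : IsNilpotent xN)
    (z : M ⊗[k] N →ₗ[k] M ⊗[k] N) (hz : IsSuperTensorMap k M0 M1 xM xN z)
    (FM : ℤ → Submodule k M) (hFM : IsDeligneFiltration k FM xM)
    (FN : ℤ → Submodule k N) (hFN : IsDeligneFiltration k FN xN)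
    (FT : ℤ → Submodule k (M ⊗[k] N)) (hFT : IsDeligneFiltration k FT z) :
    IsNilpotent z ∧
    (∀ a b : ℤ, ∀ v ∈ FM (2*a), ∀ w ∈ FN (2*b), v ⊗ₜ[k] w ∈ FT (2*(a+b))) ∧
    (∀ a b : ℤ, ∀ v ∈ FM (2*a - 1), ∀ w ∈ FN (2*b), v ⊗ₜ[k] w ∈ FT (2*(a+b) - 1)) ∧
    (∀ a b : ℤ, ∀ v ∈ FM (2*a), ∀ w ∈ FN (2*b - 1), v ⊗ₜ[k] w ∈ FT (2*(a+b) - 1)) := by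
  obtain ⟨σ, hσ0, hσ1⟩ := exists_parity M0 M1 hcM
  have split : ∀ (P : M → Prop), (∀ v ∈ M0, P v) → (∀ v ∈ M1, P v) →
      (∀ u v, P u → P v → P (u + v)) → ∀ v, P v := by
    intro P h0 h1 ha v
    obtain ⟨p, hp, q, hq, rfl⟩ := Submodule.mem_sup.1
      (show v ∈ M0 ⊔ M1 by rw [hcM.sup_eq_top]; trivial)
    exact ha _ _ (h0 p hp) (h1 q hq)
  have hσσ : ∀ v, σ (σ v) = v := split _ (fun v hv => by rw [hσ0 v hv, hσ0 v hv])
    (fun v hv => by rw [hσ1 v hv, map_neg, hσ1 v hv, neg_neg])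
    (fun u v hu hv => by rw [map_add, map_add, hu, hv])
  have hσx : ∀ v, σ (xM v) = -xM (σ v) := split _
    (fun v hv => by rw [hσ0 v hv, hσ1 _ (hxModd.1 v hv)])
    (fun v hv => by rw [hσ1 v hv, hσ0 _ (hxModd.2 v hv), map_neg, neg_neg])
    (fun u v hu hv => by simp only [map_add, hu, hv]; abel)
  have hzt : ∀ v w, z (v ⊗ₜ[k] w) = xM v ⊗ₜ[k] w + σ v ⊗ₜ[k] xN w := by
    intro v w
    refine split (fun v => z (v ⊗ₜ[k] w) = xM v ⊗ₜ[k] w + σ v ⊗ₜ[k] xN w)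
      (fun v hv => ?_) (fun v hv => ?_) (fun u v hu hv => ?_) v
    · rw [hz.1 v hv, hσ0 v hv]
    · rw [hz.2 v hv, hσ1 v hv, TensorProduct.neg_tmul, sub_eq_add_neg]
    · simp only [TensorProduct.add_tmul, map_add, hu, hv]; abel
  have hz2 : z ^ 2 = tsum' (xM ^ 2) (xN ^ 2) := by
    refine TensorProduct.ext' fun v w => ?_
    rw [tsum_tmul, pow_two, pow_two, pow_two]
    simp only [Module.End.mul_apply, hzt, map_add, hσx, hσσ, TensorProduct.neg_tmul]
    abel
  have hznil : IsNilpotent z := by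
    have : IsNilpotent (z ^ 2) := by
      rw [hz2]
      exact tsum_nil _ _ (hxMnil.pow_of_pos two_ne_zero) (hxNnil.pow_of_pos two_ne_zero)
    exact IsNilpotent.of_pow this
  have hσE : ∀ (a : ℤ) v, v ∈ wt (xM ^ 2) a → σ v ∈ wt (xM ^ 2) a := by
    intro a v hv
    refine wt_map _ _ σ (fun v => ?_) a hv
    simp only [pow_two, Module.End.mul_apply, hσx, map_neg, neg_neg]
  have hE : ∀ (a b c : ℤ) v w, c = a + b → v ∈ wt (xM ^ 2) a → w ∈ wt (xN ^ 2) b →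
      v ⊗ₜ[k] w ∈ wt (z ^ 2) c := by
    rintro a b c v w rfl hv hw
    rw [hz2]
    exact wt_tensor _ _ a b hv hw
  refine ⟨hznil, fun a b v hv w hw => ?_, fun a b v hv w hw => ?_, fun a b v hv w hw => ?_⟩
  · obtain ⟨v1, v2⟩ := wt_even_le xM a (deligne_le_wt hFM hxMnil _ hv)
    obtain ⟨w1, w2⟩ := wt_even_le xN b (deligne_le_wt hFN hxNnil _ hw)
    refine wt_le_deligne hFT _ (wt_sq_even z hznil _ (hE a b _ _ _ rfl v1 w1) ?_)
    rw [hzt]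
    exact Submodule.add_mem _ (hE (a - 1) b _ _ _ (by ring) v2 w1)
      (hE a (b - 1) _ _ _ (by ring) (hσE _ _ v1) w2)
  · obtain ⟨e, he, v', hv', rfl⟩ := wt_odd_le xM a (deligne_le_wt hFM hxMnil _ hv)
    obtain ⟨w1, w2⟩ := wt_even_le xN b (deligne_le_wt hFN hxNnil _ hw)
    have h1 := wt_sq_odd z (a + b) (hE (a - 1) b _ _ _ (by ring) he w1)
    have h2 := wt_sq_odd' z (a + b) (hE a b _ _ _ rfl hv' w1)
    have h3 := wt_sq_odd z (a + b) (hE a (b - 1) _ _ _ (by ring) (hσE _ _ hv') w2)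
    have : (e + xM v') ⊗ₜ[k] w = e ⊗ₜ[k] w + (z (v' ⊗ₜ[k] w) - σ v' ⊗ₜ[k] xN w) := by
      rw [hzt, TensorProduct.add_tmul]; abel
    rw [this]
    exact wt_le_deligne hFT _ (Submodule.add_mem _ h1 (Submodule.sub_mem _ h2 h3))
  · obtain ⟨v1, v2⟩ := wt_even_le xM a (deligne_le_wt hFM hxMnil _ hv)
    obtain ⟨e, he, w', hw', rfl⟩ := wt_odd_le xN b (deligne_le_wt hFN hxNnil _ hw)
    have h1 := wt_sq_odd z (a + b) (hE a (b - 1) _ _ _ (by ring) v1 he)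
    have h2 := wt_sq_odd' z (a + b) (hE a b _ _ _ rfl (hσE _ _ v1) hw')
    have h3 := wt_sq_odd z (a + b) (hE (a - 1) b _ _ _ (by ring) (hσE _ _ v2) hw')
    have : v ⊗ₜ[k] (e + xN w') = v ⊗ₜ[k] e + (z (σ v ⊗ₜ[k] w') + σ (xM v) ⊗ₜ[k] w') := by
      rw [hzt, hσσ, hσx, TensorProduct.tmul_add, TensorProduct.neg_tmul]; abel
    rw [this]
    exact wt_le_deligne hFT _ (Submodule.add_mem _ h1 (Submodule.add_mem _ h2 h3))
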